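/- arXiv:math/9811108 — 3 statements merged into one kernel-verified Lean document; each statement's English description precedes it below -/
import Mathlib

section
/- Let K be the field of iterated formal Laurent series ℚ((x_n))((x_{n-1}))...((x_1)) (so that for i < j the element x_j - x_i is invertible in K, with inverse expanded as a geometric series in x_i/x_j, and 1 - x_i is invertible with inverse the geometric series in x_i). Then the coefficient of the monomial x_1^0 x_2^0 ⋯ x_n^0 in the element ∏_{i=1}^{n} (1-x_i)^{-2} · ∏_{1 ≤ i < j ≤ n} (x_j - x_i)^{-1} of K equals ∏_{i=1}^{n} (1/(i+1)) · binomial(2i, i), the product of the first n Catalan numbers. -/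
/-- Auxiliary: the iterated Laurent series field `ℚ((x_n))((x_{n-1}))⋯((x_1))`,
built by recursion and bundled with its field structure (each step adjoins a new,
more infinitesimal, Laurent variable on the outside). -/
noncomputable def IterLaurentAux : ℕ → (K : Type) × Field K
  | 0 => ⟨ℚ, inferInstance⟩
  | n + 1 =>
    letI := (IterLaurentAux n).2
    ⟨LaurentSeries (IterLaurentAux n).1, inferInstance⟩

/-- `IterLaurent n` is the iterated formal Laurent series field
`ℚ((x_n))((x_{n-1}))⋯((x_1))`, in which `x_i` is infinitesimal with respect to
`x_j` for `i < j`. -/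
noncomputable def IterLaurent (n : ℕ) : Type := (IterLaurentAux n).1

noncomputable instance (n : ℕ) : Field (IterLaurent n) := (IterLaurentAux n).2

/-- The variables: `IterLaurent.X n i` is `x_{i+1}` (0-indexed). The variable of
index `0`, i.e. `x_1`, is the outermost, most infinitesimal, Laurent variable;
the remaining variables are included from `IterLaurent n` via the constant
embedding `HahnSeries.C`. -/
noncomputable def IterLaurent.X : ∀ n, Fin n → IterLaurent n
  | n + 1, i =>
    show LaurentSeries (IterLaurent n) from
      Fin.cases (HahnSeries.single (1 : ℤ) (1 : IterLaurent n))
        (fun j => HahnSeries.C (IterLaurent.X n j)) i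

/-- The constant term `CT_{x_n} ⋯ CT_{x_1}`: the coefficient of the monomial
`x_1^0 x_2^0 ⋯ x_n^0` of an iterated Laurent series. -/
noncomputable def IterLaurent.CT : ∀ n, IterLaurent n → ℚ
  | 0, f => f
  | n + 1, f => IterLaurent.CT n ((show LaurentSeries (IterLaurent n) from f).coeff 0)

lemma Derivation.map_prod_of_map_eq_mul {K ι : Type*} [CommRing K] (D : Derivation ℤ K K)
    (s : Finset ι) (f g : ι → K) (h : ∀ i ∈ s, D (f i) = f i * g i) :
    D (∏ i ∈ s, f i) = (∏ i ∈ s, f i) * ∑ i ∈ s, g i := by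
  classical
  induction s using Finset.induction_on with
  | empty => simp
  | insert a s ha ih =>
    rw [Finset.prod_insert ha, Finset.sum_insert ha, D.leibniz,
      ih fun i hi => h i (Finset.mem_insert_of_mem hi), h a (Finset.mem_insert_self a s),
      smul_eq_mul, smul_eq_mul]
    ring

section SymmetricSums

variable {K : Type*} [Field K] {n : ℕ}

/-- The sum over all permutations `w` of the monomials `x_{w 0} ⋯ x_{w (p-1)}`. -/
def permMonomialSum (x : Fin n → K) (p : ℕ) : K :=
  ∑ w : Equiv.Perm (Fin n), ∏ m with m.val < p, x (w m)

lemma sum_perm_mul_swap {M : Type*} [AddCommMonoid M] (p q : Fin n)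
    (f : Equiv.Perm (Fin n) → M) : ∑ w, f (w * Equiv.swap p q) = ∑ w, f w :=
  Equiv.sum_comp (Equiv.mulRight (Equiv.swap p q)) f

lemma prod_mul_swap (x : Fin n → K) (w : Equiv.Perm (Fin n)) {p q : Fin n} {l : ℕ}
    (h : p.val < l ↔ q.val < l) :
    ∏ m with m.val < l, x ((w * Equiv.swap p q) m) = ∏ m : Fin n with m.val < l, x (w m) := by
  refine Finset.prod_bij' (fun m _ => Equiv.swap p q m) (fun m _ => Equiv.swap p q m)
    ?_ ?_ (by simp) (by simp) (by simp)
  all_goals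
    intro m hm
    simp only [Finset.mem_filter, Finset.mem_univ, true_and] at hm ⊢
    rw [Equiv.swap_apply_def]
    split_ifs with h1 h2
    · subst h1; exact h.1 hm
    · subst h2; exact h.2 hm
    · exact hm

lemma prod_filter_lt_succ (x : Fin n → K) (p : Fin n) :
    ∏ m with m.val < p.val + 1, x m = (∏ m with m.val < p.val, x m) * x p := by
  have : (Finset.univ.filter fun m : Fin n => m.val < p.val + 1) =
      insert p (Finset.univ.filter fun m : Fin n => m.val < p.val) := by
    ext m
    simp only [Finset.mem_filter, Finset.mem_univ, true_and, Finset.mem_insert, Fin.ext_iff]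
    omega
  rw [this, Finset.prod_insert (by simp), mul_comm]

lemma two_mul_sum_perm_of_lt {x : Fin n → K} (hx : Function.Injective x) {p q : Fin n}
    (h : q < p) :
    2 * ∑ w : Equiv.Perm (Fin n), (∏ m with m.val < p.val, x (w m)) *
      (x (w p) * (1 - x (w p)) / (x (w p) - x (w q))) = -permMonomialSum x (p + 1) := by
  rw [two_mul]
  nth_rewrite 1 [← sum_perm_mul_swap p q]
  rw [← Finset.sum_add_distrib, permMonomialSum, ← Finset.sum_neg_distrib]
  refine Finset.sum_congr rfl fun w _ => ?_
  have hlt : q.val < p.val := h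
  have hswap := prod_mul_swap x w (p := p) (q := q) (l := p.val + 1) (by omega)
  rw [prod_filter_lt_succ (fun m => x ((w * Equiv.swap p q) m)),
    prod_filter_lt_succ (fun m => x (w m))] at hswap
  rw [prod_filter_lt_succ (fun m => x (w m))]
  have h1 : x (w p) - x (w q) ≠ 0 := sub_ne_zero.2 (hx.ne (w.injective.ne h.ne'))
  have h2 : x (w q) - x (w p) ≠ 0 := sub_ne_zero.2 (hx.ne (w.injective.ne h.ne))
  simp only [Equiv.Perm.mul_apply, Equiv.swap_apply_left, Equiv.swap_apply_right] at hswap ⊢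
  rw [mul_div_assoc, mul_div_assoc, ← mul_assoc, hswap, ← mul_assoc, ← mul_add]
  have : (1 - x (w q)) / (x (w q) - x (w p)) + (1 - x (w p)) / (x (w p) - x (w q)) = -1 := by
    field_simp
    ring
  rw [this]
  ring

lemma two_mul_sum_perm_of_gt {x : Fin n → K} (hx : Function.Injective x) {p q : Fin n}
    (h : p < q) :
    2 * ∑ w : Equiv.Perm (Fin n), (∏ m with m.val < p.val, x (w m)) *
      (x (w p) * (1 - x (w p)) / (x (w p) - x (w q))) =
      permMonomialSum x p - 2 * permMonomialSum x (p + 1) := by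
  have hlt : p.val < q.val := h
  have hswap (w : Equiv.Perm (Fin n)) :=
    prod_mul_swap x w (p := p) (q := q) (l := p.val) (by omega)
  have hq : permMonomialSum x (p + 1) =
      ∑ w : Equiv.Perm (Fin n), (∏ m with m.val < p.val, x (w m)) * x (w q) := by
    rw [permMonomialSum, ← sum_perm_mul_swap p q]
    refine Finset.sum_congr rfl fun w _ => ?_
    rw [prod_filter_lt_succ (fun m => x ((w * Equiv.swap p q) m)), hswap]
    simp
  rw [two_mul, two_mul]
  nth_rewrite 1 [← sum_perm_mul_swap p q]
  nth_rewrite 2 [hq]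
  rw [← Finset.sum_add_distrib, permMonomialSum, permMonomialSum, ← Finset.sum_add_distrib,
    ← Finset.sum_sub_distrib]
  refine Finset.sum_congr rfl fun w _ => ?_
  rw [prod_filter_lt_succ (fun m => x (w m)), hswap]
  have h1 : x (w p) - x (w q) ≠ 0 := sub_ne_zero.2 (hx.ne (w.injective.ne h.ne))
  have h2 : x (w q) - x (w p) ≠ 0 := sub_ne_zero.2 (hx.ne (w.injective.ne h.ne'))
  simp only [Equiv.Perm.mul_apply, Equiv.swap_apply_left, Equiv.swap_apply_right]
  have : x (w q) * (1 - x (w q)) / (x (w q) - x (w p)) +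
      x (w p) * (1 - x (w p)) / (x (w p) - x (w q)) = 1 - x (w p) - x (w q) := by
    field_simp
    ring
  rw [← mul_add, this]
  ring

end SymmetricSums

section Vandermonde

variable {R : Type*} [CommRing R] {n : ℕ}

/-- The Vandermonde product `∏_{i < j} (x_j - x_i)`. -/
def vandermondeProd (x : Fin n → R) : R :=
  ∏ p ∈ Finset.univ.filter (fun p : Fin n × Fin n => p.1 < p.2), (x p.2 - x p.1)

lemma vandermondeProd_succ (x : Fin (n + 1) → R) :
    vandermondeProd x = (∏ j : Fin n, (x j.succ - x 0)) * vandermondeProd fun j => x j.succ := by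
  simp [vandermondeProd, Finset.prod_filter, Fintype.prod_prod_type, Fin.prod_univ_succ]

lemma RingHom.map_vandermondeProd {S : Type*} [CommRing S] (f : R →+* S) (x : Fin n → R) :
    f (vandermondeProd x) = vandermondeProd fun i => f (x i) := by
  simp [vandermondeProd]

end Vandermonde

section AomotoRecurrence

variable {K : Type*} [Field K] {n : ℕ}

/-- The denominator `∏ (1 - x_i)² x_i ∏_{i < j} (x_j - x_i)`. -/
def morrisDenom (x : Fin n → K) : K :=
  (∏ i, (1 - x i) ^ 2) * (∏ i, x i) * vandermondeProd x

lemma Derivation.map_vandermondeProd {x : Fin n → K} (hx : Function.Injective x) {i : Fin n}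
    (D : Derivation ℤ K K) (hD : ∀ j, D (x j) = if j = i then x i else 0) :
    D (vandermondeProd x) =
      vandermondeProd x * ∑ j ∈ Finset.univ.erase i, x i / (x i - x j) := by
  rw [vandermondeProd, D.map_prod_of_map_eq_mul (g := fun p =>
    (if p.2 = i then x i / (x i - x p.1) else 0) + (if p.1 = i then x i / (x i - x p.2) else 0))]
  · congr 1
    rw [Finset.sum_filter, Fintype.sum_prod_type]
    simp only [ite_add_zero, Finset.sum_add_distrib]
    have h1 : ∑ a : Fin n, ∑ b : Fin n,
        (if a < b then (if b = i then x i / (x i - x a) else 0) else 0) =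
        ∑ a : Fin n, if a < i then x i / (x i - x a) else 0 := by
      refine Finset.sum_congr rfl fun a _ => ?_
      rw [Finset.sum_eq_single i] <;> simp +contextual
    have h2 : ∑ a : Fin n, ∑ b : Fin n,
        (if a < b then (if a = i then x i / (x i - x b) else 0) else 0) =
        ∑ b : Fin n, if i < b then x i / (x i - x b) else 0 := by
      rw [Finset.sum_comm]
      refine Finset.sum_congr rfl fun b _ => ?_
      rw [Finset.sum_eq_single i] <;> simp +contextual
    rw [h1, h2, ← Finset.sum_add_distrib, ← Finset.filter_ne', Finset.sum_filter]
    refine Finset.sum_congr rfl fun a _ => ?_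
    rcases lt_trichotomy a i with h | h | h
    · simp [h, h.ne, h.not_gt]
    · simp [h]
    · simp [h, h.ne', h.not_gt]
  · rintro ⟨a, b⟩ hab
    simp only [Finset.mem_filter, Finset.mem_univ, true_and] at hab
    have h1 : x b - x a ≠ 0 := sub_ne_zero.2 (hx.ne hab.ne')
    have h2 : x a - x b ≠ 0 := sub_ne_zero.2 (hx.ne hab.ne)
    simp only [map_sub, hD]
    split_ifs with hb ha ha
    · exact absurd (ha.trans hb.symm) hab.ne
    · subst hb; field_simp; ring
    · subst ha; field_simp; ring
    · ring

lemma map_morrisDenom {x : Fin n → K} (hx : Function.Injective x) (hx1 : ∀ i, 1 - x i ≠ 0)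
    {i : Fin n} (D : Derivation ℤ K K) (hD : ∀ j, D (x j) = if j = i then x i else 0) :
    D (morrisDenom x) = morrisDenom x *
      (-2 * x i / (1 - x i) + 1 + ∑ j ∈ Finset.univ.erase i, x i / (x i - x j)) := by
  have h1 : D (∏ j, (1 - x j) ^ 2) = (∏ j, (1 - x j) ^ 2) * (-2 * x i / (1 - x i)) := by
    rw [D.map_prod_of_map_eq_mul (g := fun j => if j = i then -2 * x i / (1 - x i) else 0)]
    · simp
    · intro j _
      rw [D.leibniz_pow, map_sub, D.map_one_eq_zero, hD]
      split_ifs with h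
      · subst h
        have := hx1 j
        simp only [nsmul_eq_mul, smul_eq_mul]
        field_simp
        push_cast
        ring
      · simp
  have h2 : D (∏ j, x j) = ∏ j, x j := by
    rw [D.map_prod_of_map_eq_mul (g := fun j => if j = i then 1 else 0)]
    · simp
    · intro j _
      rw [hD]
      split_ifs with h <;> simp [h]
  rw [morrisDenom, D.leibniz, D.leibniz, h1, h2, D.map_vandermondeProd hx hD]
  simp only [smul_eq_mul]
  ring

lemma vandermondeProd_ne_zero {x : Fin n → K} (hx : Function.Injective x) :
    vandermondeProd x ≠ 0 := by
  refine Finset.prod_ne_zero_iff.2 fun p hp => ?_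
  simp only [Finset.mem_filter, Finset.mem_univ, true_and] at hp
  exact sub_ne_zero.2 (hx.ne hp.ne')

lemma morrisDenom_ne_zero {x : Fin n → K} (hx : Function.Injective x) (hx0 : ∀ i, x i ≠ 0)
    (hx1 : ∀ i, 1 - x i ≠ 0) : morrisDenom x ≠ 0 :=
  mul_ne_zero (mul_ne_zero (Finset.prod_ne_zero_iff.2 fun i _ => pow_ne_zero 2 (hx1 i))
    (Finset.prod_ne_zero_iff.2 fun i _ => hx0 i)) (vandermondeProd_ne_zero hx)

lemma map_mul_prod_mul_inv_morrisDenom {x : Fin n → K} (hx : Function.Injective x)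
    (hx0 : ∀ i, x i ≠ 0) (hx1 : ∀ i, 1 - x i ≠ 0) (w : Equiv.Perm (Fin n)) (p : Fin n)
    (D : Derivation ℤ K K) (hD : ∀ j, D (x j) = if j = w p then x (w p) else 0) :
    D ((1 - x (w p)) * (∏ m with m.val < p.val, x (w m)) * (morrisDenom x)⁻¹) =
      (morrisDenom x)⁻¹ * ((∏ m with m.val < p.val, x (w m)) * (2 * x (w p) - 1) -
        ∑ q ∈ Finset.univ.erase p, (∏ m with m.val < p.val, x (w m)) *
          (x (w p) * (1 - x (w p)) / (x (w p) - x (w q)))) := by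
  have hA : D (∏ m with m.val < p.val, x (w m)) = 0 := by
    rw [D.map_prod_of_map_eq_mul (g := fun _ => 0)]
    · simp
    · intro m hm
      simp only [Finset.mem_filter, Finset.mem_univ, true_and] at hm
      rw [hD, if_neg (w.injective.ne (Fin.ne_of_lt hm)), mul_zero]
  have hsum : ∑ j ∈ Finset.univ.erase (w p), x (w p) / (x (w p) - x j) =
      ∑ q ∈ Finset.univ.erase p, x (w p) / (x (w p) - x (w q)) := by
    refine (Finset.sum_bij (fun q _ => w q) ?_ ?_ ?_ ?_).symm
    · simp
    · simp
    · intro b hb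
      refine ⟨w.symm b, ?_, by simp⟩
      simpa [Equiv.symm_apply_eq] using hb
    · simp
  have hV := morrisDenom_ne_zero hx hx0 hx1
  have h1 := hx1 (w p)
  have hsum' : ∑ q ∈ Finset.univ.erase p, (∏ m with m.val < p.val, x (w m)) *
      (x (w p) * (1 - x (w p)) / (x (w p) - x (w q))) = (∏ m with m.val < p.val, x (w m)) *
      (1 - x (w p)) * ∑ q ∈ Finset.univ.erase p, x (w p) / (x (w p) - x (w q)) := by
    rw [Finset.mul_sum]
    exact Finset.sum_congr rfl fun q _ => by ring
  rw [hsum', D.leibniz, D.leibniz, hA, map_sub, D.map_one_eq_zero, hD, if_pos rfl, D.leibniz_inv,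
    map_morrisDenom hx hx1 D hD, hsum]
  simp only [smul_eq_mul]
  field_simp
  ring

/-- **Aomoto's recurrence** for an additive functional killing the Euler derivations. -/
lemma map_permMonomialSum_succ {x : Fin n → K} (hx : Function.Injective x)
    (hx0 : ∀ i, x i ≠ 0) (hx1 : ∀ i, 1 - x i ≠ 0) (D : Fin n → Derivation ℤ K K)
    (hD : ∀ i j, D i (x j) = if j = i then x i else 0) (L : K →+ ℚ) (hL : ∀ i f, L (D i f) = 0)
    (p : ℕ) (hp : p < n) :
    ((2 * n + 2 - p : ℕ) : ℚ) * L ((morrisDenom x)⁻¹ * permMonomialSum x (p + 1)) =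
      ((n + 1 - p : ℕ) : ℚ) * L ((morrisDenom x)⁻¹ * permMonomialSum x p) := by
  obtain ⟨p, rfl⟩ : ∃ p' : Fin n, p'.val = p := ⟨⟨p, hp⟩, rfl⟩
  set V := (morrisDenom x)⁻¹
  set S := permMonomialSum x p with hS
  set S' := permMonomialSum x (p + 1) with hS'
  have hpair : ∀ q ∈ Finset.univ.erase p,
      2 * ∑ w : Equiv.Perm (Fin n), (∏ m with m.val < p.val, x (w m)) *
        (x (w p) * (1 - x (w p)) / (x (w p) - x (w q))) =
      if q < p then -S' else S - 2 * S' := by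
    intro q hq
    split_ifs with h
    · exact two_mul_sum_perm_of_lt hx h
    · exact two_mul_sum_perm_of_gt hx
        (lt_of_le_of_ne (not_lt.1 h) (Finset.ne_of_mem_erase hq).symm)
  have hcount : ∑ q ∈ Finset.univ.erase p, (if q < p then -S' else S - 2 * S') =
      (p.val : K) * (-S') + ((n - 1 - p.val : ℕ) : K) * (S - 2 * S') := by
    have e1 : ((Finset.univ.erase p).filter fun q => q < p) = Finset.Iio p := by
      ext q; simpa using fun h : q < p => h.ne
    have e2 : ((Finset.univ.erase p).filter fun q => ¬ q < p) = Finset.Ioi p := by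
      ext q
      simp only [Finset.mem_filter, Finset.mem_erase, Finset.mem_univ, Finset.mem_Ioi, not_lt]
      exact ⟨fun h => lt_of_le_of_ne h.2 h.1.1.symm, fun h => ⟨⟨h.ne', trivial⟩, h.le⟩⟩
    rw [Finset.sum_ite, e1, e2]
    simp only [Finset.sum_const, Fin.card_Iio, Fin.card_Ioi, nsmul_eq_mul]
  have hlin : ∑ w : Equiv.Perm (Fin n),
      (∏ m with m.val < p.val, x (w m)) * (2 * x (w p) - 1) = 2 * S' - S := by
    rw [hS', hS, permMonomialSum, permMonomialSum, Finset.mul_sum, ← Finset.sum_sub_distrib]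
    refine Finset.sum_congr rfl fun w _ => ?_
    rw [prod_filter_lt_succ (fun m => x (w m))]
    ring
  have key : 2 * ∑ w : Equiv.Perm (Fin n),
      D (w p) ((1 - x (w p)) * (∏ m with m.val < p.val, x (w m)) * V) =
      ((2 * n + 2 - p.val : ℕ) : K) * (V * S') - ((n + 1 - p.val : ℕ) : K) * (V * S) := by
    rw [Finset.sum_congr rfl fun w _ =>
      map_mul_prod_mul_inv_morrisDenom hx hx0 hx1 w p (D (w p)) (hD (w p)),
      ← Finset.mul_sum, Finset.sum_sub_distrib, hlin, Finset.sum_comm]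
    have h2 := Finset.sum_congr rfl hpair
    rw [← Finset.mul_sum, hcount] at h2
    rw [mul_left_comm, mul_sub, h2]
    obtain ⟨d, hd⟩ : ∃ d, n = p.val + 1 + d := ⟨n - (p.val + 1), by omega⟩
    rw [show 2 * n + 2 - p.val = p.val + 2 * d + 4 by omega,
      show n + 1 - p.val = d + 2 by omega, show n - 1 - p.val = d by omega]
    push_cast
    ring
  have hzero := congrArg L key
  rw [two_mul, map_add, map_sum, Finset.sum_eq_zero fun w _ => hL _ _, add_zero, map_sub,
    ← nsmul_eq_mul, ← nsmul_eq_mul, map_nsmul, map_nsmul, nsmul_eq_mul, nsmul_eq_mul] at hzero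
  exact (sub_eq_zero.1 hzero.symm)

lemma permMonomialSum_zero (x : Fin n → K) : permMonomialSum x 0 = (n.factorial : K) := by
  simp [permMonomialSum, Fintype.card_perm]

lemma permMonomialSum_self (x : Fin n → K) :
    permMonomialSum x n = (n.factorial : K) * ∏ i, x i := by
  simp [permMonomialSum, Fintype.card_perm, Equiv.prod_comp]

lemma map_inv_morrisDenom {x : Fin n → K} (hx : Function.Injective x)
    (hx0 : ∀ i, x i ≠ 0) (hx1 : ∀ i, 1 - x i ≠ 0) (D : Fin n → Derivation ℤ K K)
    (hD : ∀ i j, D i (x j) = if j = i then x i else 0) (L : K →+ ℚ) (hL : ∀ i f, L (D i f) = 0) :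
    L (morrisDenom x)⁻¹ = (catalan (n + 1) : ℚ) * L ((morrisDenom x)⁻¹ * ∏ i, x i) := by
  have hrec : ∀ p ≤ n, ((2 * n + 2).descFactorial p : ℚ) *
      L ((morrisDenom x)⁻¹ * permMonomialSum x p) =
      ((n + 1).descFactorial p : ℚ) * L ((morrisDenom x)⁻¹ * permMonomialSum x 0) := by
    intro p
    induction p with
    | zero => simp
    | succ p ih =>
      intro hp
      rw [Nat.descFactorial_succ, Nat.descFactorial_succ, Nat.cast_mul, Nat.cast_mul,
        mul_right_comm, map_permMonomialSum_succ hx hx0 hx1 D hD L hL p hp, mul_assoc,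
        mul_assoc, ← ih (by omega)]
      ring
  have h := hrec n le_rfl
  have hmul (m : ℕ) (a : K) : L (m * a) = m * L a := by
    rw [← nsmul_eq_mul, map_nsmul, nsmul_eq_mul]
  rw [permMonomialSum_self, permMonomialSum_zero, mul_left_comm, mul_comm _ (n.factorial : K),
    hmul, hmul, mul_left_comm, mul_left_comm _ (n.factorial : ℚ)] at h
  have h' := mul_left_cancel₀ (Nat.cast_ne_zero.2 n.factorial_ne_zero) h
  have hc : (catalan (n + 1) : ℚ) * (n + 1).descFactorial n = (2 * n + 2).descFactorial n := by
    have h1 : (n + 1).descFactorial n = (n + 1).factorial := by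
      rw [← Nat.factorial_mul_descFactorial (Nat.le_succ n)]
      simp
    have h2 := Nat.factorial_mul_descFactorial (show n ≤ 2 * n + 2 by omega)
    have h3 := Nat.centralBinom_eq_two_mul_choose (n + 1)
    have h4 := Nat.choose_mul_factorial_mul_factorial (show n + 1 ≤ 2 * (n + 1) by omega)
    have h5 := succ_mul_catalan_eq_centralBinom (n + 1)
    rw [show 2 * n + 2 - n = n + 1 + 1 by omega, Nat.factorial_succ] at h2
    rw [← h3, ← h5, show 2 * (n + 1) - (n + 1) = n + 1 by omega,
      show 2 * (n + 1) = 2 * n + 2 by omega, ← h2] at h4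
    rw [h1]
    have h6 : 0 < (n + 1 + 1) * (n + 1).factorial := by positivity
    exact_mod_cast Nat.eq_of_mul_eq_mul_left h6 (by linarith)
  have hne : ((n + 1).descFactorial n : ℚ) ≠ 0 :=
    Nat.cast_ne_zero.2 (Nat.descFactorial_eq_zero_iff_lt.not.2 (by omega))
  refine mul_left_cancel₀ hne ?_
  rw [← h', ← hc]
  ring

end AomotoRecurrence

namespace LaurentSeries

variable {K : Type*} [Field K]

lemma support_coeff_subset (d : ℤ → K →+ K) (f : LaurentSeries K) :
    (Function.support fun m => d m (f.coeff m)) ⊆ f.support :=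
  fun m hm h0 => hm (by simp [h0])

/-- The additive endomorphism of `K((X))` acting on the coefficient of `X ^ m` by `d m`. -/
def coeffMap (d : ℤ → K →+ K) : LaurentSeries K →+ LaurentSeries K where
  toFun f := ⟨fun m => d m (f.coeff m), f.isPWO_support.mono (support_coeff_subset d f)⟩
  map_zero' := by ext m; simp
  map_add' f g := by ext m; simp

@[simp]
lemma coeff_coeffMap (d : ℤ → K →+ K) (f : LaurentSeries K) (m : ℤ) :
    (coeffMap d f).coeff m = d m (f.coeff m) :=
  rfl

lemma support_coeffMap_subset (d : ℤ → K →+ K) (f : LaurentSeries K) :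
    (coeffMap d f).support ⊆ f.support :=
  support_coeff_subset d f

lemma coeffMap_mul (d : ℤ → K →+ K)
    (hd : ∀ i j a b, d (i + j) (a * b) = a * d j b + b * d i a) (f g : LaurentSeries K) :
    coeffMap d (f * g) = f * coeffMap d g + g * coeffMap d f := by
  ext m
  rw [coeff_coeffMap, mul_comm g, HahnSeries.coeff_add, HahnSeries.coeff_mul,
    HahnSeries.coeff_mul_right' g.isPWO_support (support_coeffMap_subset d g),
    HahnSeries.coeff_mul_left' f.isPWO_support (support_coeffMap_subset d f), map_sum,
    ← Finset.sum_add_distrib]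
  refine Finset.sum_congr rfl fun ij hij => ?_
  obtain ⟨-, -, rfl⟩ := Finset.mem_antidiagonal.1 hij
  rw [hd, mul_comm (g.coeff _), coeff_coeffMap, coeff_coeffMap]

lemma coeffMap_single (d : ℤ → K →+ K) (m : ℤ) (a : K) :
    coeffMap d (HahnSeries.single m a) = HahnSeries.single m (d m a) := by
  ext k
  rw [coeff_coeffMap]
  by_cases h : k = m
  · simp [h]
  · simp [HahnSeries.coeff_single_of_ne h]

/-- The Euler operator `X d/dX` on `K((X))`. -/
def euler : LaurentSeries K →+ LaurentSeries K :=
  coeffMap fun m => AddMonoidHom.mulLeft (m : K)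

lemma euler_mul (f g : LaurentSeries K) : euler (f * g) = f * euler g + g * euler f :=
  coeffMap_mul _ (fun i j a b => by simp only [AddMonoidHom.coe_mulLeft, Int.cast_add]; ring) f g

lemma C_ne_X (a : K) : (HahnSeries.C a : LaurentSeries K) ≠ HahnSeries.single 1 1 := fun h => by
  simpa [HahnSeries.C_apply] using congrArg (fun f => HahnSeries.coeff f 1) h

lemma coeff_zero_inv_coe (P : PowerSeries K) (hP : PowerSeries.constantCoeff P ≠ 0) :
    ((HahnSeries.ofPowerSeries ℤ K P)⁻¹).coeff 0 = (PowerSeries.constantCoeff P)⁻¹ := by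
  have h : (HahnSeries.ofPowerSeries ℤ K P)⁻¹ = HahnSeries.ofPowerSeries ℤ K P⁻¹ :=
    inv_eq_of_mul_eq_one_right (by rw [← map_mul, PowerSeries.mul_inv_cancel P hP, map_one])
  rw [h, ← PowerSeries.constantCoeff_inv, ← PowerSeries.coeff_zero_eq_constantCoeff_apply]
  exact HahnSeries.ofPowerSeries_apply_coeff P⁻¹ 0

/-- Taking the constant term in the outermost variable. -/
lemma coeff_zero_inv_prod {n : ℕ} {x : Fin n → K}
    (hx : Function.Injective x) (hx0 : ∀ i, x i ≠ 0) (hx1 : ∀ i, 1 - x i ≠ 0)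
    {y : Fin (n + 1) → LaurentSeries K} (hy0 : y 0 = HahnSeries.single 1 1)
    (hy : ∀ i : Fin n, y i.succ = HahnSeries.C (x i)) :
    (((∏ i, (1 - y i) ^ 2) * vandermondeProd y)⁻¹).coeff 0 = (morrisDenom x)⁻¹ := by
  let P : PowerSeries K := ((1 - PowerSeries.X) ^ 2 * ∏ i, (1 - PowerSeries.C (x i)) ^ 2) *
    ((∏ i, (PowerSeries.C (x i) - PowerSeries.X)) * vandermondeProd fun i => PowerSeries.C (x i))
  have hP : PowerSeries.constantCoeff P = morrisDenom x := by
    simp [P, morrisDenom, map_prod, RingHom.map_vandermondeProd, mul_assoc]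
  have hy' : (∏ i, (1 - y i) ^ 2) * vandermondeProd y = HahnSeries.ofPowerSeries ℤ K P := by
    simp [P, vandermondeProd_succ, Fin.prod_univ_succ, hy0, hy, map_prod,
      RingHom.map_vandermondeProd, HahnSeries.ofPowerSeries_C]
  rw [hy', coeff_zero_inv_coe P (hP ▸ morrisDenom_ne_zero hx hx0 hx1), hP]

end LaurentSeries

namespace IterLaurent

lemma X_zero (n : ℕ) :
    X (n + 1) 0 = (HahnSeries.single (1 : ℤ) (1 : IterLaurent n) : LaurentSeries (IterLaurent n)) :=
  rfl

lemma X_succ (n : ℕ) (i : Fin n) :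
    X (n + 1) i.succ = (HahnSeries.C (X n i) : LaurentSeries (IterLaurent n)) :=
  rfl

lemma X_ne_zero : ∀ (n : ℕ) (i : Fin n), X n i ≠ 0
  | n + 1, i => by
    refine Fin.cases ?_ (fun j => ?_) i
    · exact (HahnSeries.single_ne_zero one_ne_zero :
        (HahnSeries.single (1 : ℤ) (1 : IterLaurent n)) ≠ 0)
    · exact (HahnSeries.C_ne_zero (X_ne_zero n j) :
        (HahnSeries.C (X n j) : LaurentSeries (IterLaurent n)) ≠ 0)

lemma X_ne_one : ∀ (n : ℕ) (i : Fin n), X n i ≠ 1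
  | n + 1, i => by
    refine Fin.cases ?_ (fun j => ?_) i
    · exact (LaurentSeries.C_ne_X (1 : IterLaurent n)).symm
    · exact fun h => X_ne_one n j (HahnSeries.C_injective (Γ := ℤ) h)

lemma X_injective : ∀ n : ℕ, Function.Injective (X n)
  | 0 => fun i => i.elim0
  | n + 1 => by
    intro i j
    refine Fin.cases ?_ (fun i => ?_) i <;> refine Fin.cases ?_ (fun j => ?_) j
    · exact fun _ => rfl
    · exact fun h => absurd h.symm (LaurentSeries.C_ne_X (X n j))
    · exact fun h => absurd h (LaurentSeries.C_ne_X (X n i))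
    · exact fun h => congrArg Fin.succ (X_injective n (HahnSeries.C_injective (Γ := ℤ) h))

/-- The Euler operators `x_i ∂/∂x_i`. -/
noncomputable def euler : ∀ n, Fin n → (IterLaurent n →+ IterLaurent n)
  | n + 1, i =>
    show LaurentSeries (IterLaurent n) →+ LaurentSeries (IterLaurent n) from
      Fin.cases LaurentSeries.euler (fun j => LaurentSeries.coeffMap fun _ => euler n j) i

lemma euler_mul : ∀ (n : ℕ) (i : Fin n) (f g : IterLaurent n),
    euler n i (f * g) = f * euler n i g + g * euler n i f
  | n + 1, i => by
    refine Fin.cases ?_ (fun j => ?_) i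
    · exact LaurentSeries.euler_mul (K := IterLaurent n)
    · exact LaurentSeries.coeffMap_mul (K := IterLaurent n) (fun _ => euler n j)
        fun _ _ => euler_mul n j

lemma euler_one (n : ℕ) (i : Fin n) : euler n i 1 = 0 := by
  simpa using euler_mul n i 1 1

lemma euler_X : ∀ (n : ℕ) (i j : Fin n), euler n i (X n j) = if j = i then X n i else 0
  | n + 1, i, j => by
    refine Fin.cases ?_ (fun i => ?_) i <;> refine Fin.cases ?_ (fun j => ?_) j
    · rw [if_pos rfl]
      refine (LaurentSeries.coeffMap_single (K := IterLaurent n) _ 1 1).trans ?_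
      simp [X_zero]
    · rw [if_neg (Fin.succ_ne_zero j)]
      refine (LaurentSeries.coeffMap_single (K := IterLaurent n) _ 0 _).trans ?_
      rw [AddMonoidHom.coe_mulLeft, Int.cast_zero, zero_mul]
      exact HahnSeries.single_eq_zero
    · rw [if_neg (Fin.succ_ne_zero i).symm]
      refine (LaurentSeries.coeffMap_single (K := IterLaurent n) _ 1 1).trans ?_
      rw [euler_one]
      exact HahnSeries.single_eq_zero
    · refine (LaurentSeries.coeffMap_single (K := IterLaurent n) _ 0 _).trans ?_
      rw [euler_X n i j]
      simp only [Fin.succ_inj]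
      split_ifs
      · rfl
      · exact HahnSeries.single_eq_zero

/-- The constant term as an additive map. -/
noncomputable def ctHom : ∀ n, IterLaurent n →+ ℚ
  | 0 => AddMonoidHom.id ℚ
  | n + 1 => (ctHom n).comp
      (HahnSeries.coeff.addMonoidHom 0 : LaurentSeries (IterLaurent n) →+ IterLaurent n)

lemma ctHom_apply : ∀ (n : ℕ) (f : IterLaurent n), ctHom n f = CT n f
  | 0, _ => rfl
  | n + 1, _ => ctHom_apply n _

lemma ctHom_euler : ∀ (n : ℕ) (i : Fin n) (f : IterLaurent n), ctHom n (euler n i f) = 0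
  | n + 1, i, _ => by
    refine Fin.cases ?_ (fun j => ?_) i
    · refine (congrArg (ctHom n) ?_).trans (map_zero (ctHom n))
      change ((0 : ℤ) : IterLaurent n) * _ = 0
      rw [Int.cast_zero, zero_mul]
    · exact ctHom_euler n j _

lemma one_sub_X_ne_zero (n : ℕ) (i : Fin n) : 1 - X n i ≠ 0 :=
  sub_ne_zero.2 (X_ne_one n i).symm

/-- The Euler operators bundled as derivations. -/
noncomputable def eulerDerivation (n : ℕ) (i : Fin n) :
    Derivation ℤ (IterLaurent n) (IterLaurent n) :=
  Derivation.mk' (euler n i).toIntLinearMap (euler_mul n i)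

lemma CT_inv_succ (n : ℕ) :
    CT (n + 1) ((∏ i, (1 - X (n + 1) i) ^ 2) * vandermondeProd (X (n + 1)))⁻¹ =
      CT n (morrisDenom (X n))⁻¹ :=
  congrArg (CT n) (LaurentSeries.coeff_zero_inv_prod (X_injective n) (X_ne_zero n)
    (one_sub_X_ne_zero n) (X_zero n) (X_succ n))

lemma CT_inv_morrisDenom (n : ℕ) :
    CT n (morrisDenom (X n))⁻¹ = (catalan (n + 1) : ℚ) *
      CT n ((∏ i, (1 - X n i) ^ 2) * vandermondeProd (X n))⁻¹ := by
  rw [← ctHom_apply, ← ctHom_apply, map_inv_morrisDenom (X_injective n) (X_ne_zero n)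
    (one_sub_X_ne_zero n) (eulerDerivation n) (euler_X n) (ctHom n) (ctHom_euler n)]
  congr 2
  have h : ∏ i, X n i ≠ 0 := Finset.prod_ne_zero_iff.2 fun i _ => X_ne_zero n i
  rw [morrisDenom, mul_right_comm, mul_inv_rev, mul_comm _ (∏ i, X n i), mul_inv_cancel_left₀ h]

lemma CT_inv_eq_prod_catalan : ∀ n : ℕ,
    CT n ((∏ i, (1 - X n i) ^ 2) * vandermondeProd (X n))⁻¹ =
      ∏ i ∈ Finset.Icc 1 n, (catalan i : ℚ)
  | 0 => by
    have h : ((∏ i, (1 - X 0 i) ^ 2) * vandermondeProd (X 0))⁻¹ = 1 := by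
      simp [vandermondeProd]
    rw [h, Finset.Icc_eq_empty (by decide), Finset.prod_empty]
    rfl
  | n + 1 => by
    rw [CT_inv_succ, CT_inv_morrisDenom, CT_inv_eq_prod_catalan n,
      Finset.prod_Icc_succ_top (by omega), mul_comm]

end IterLaurent

/-- **The Chan–Robbins–Yuen conjecture** (constant term form): in the iterated
Laurent series field `ℚ((x_n))⋯((x_1))`, the coefficient of `x_1^0 ⋯ x_n^0` in
`∏_{i=1}^{n} (1-x_i)^{-2} ∏_{1 ≤ i < j ≤ n} (x_j - x_i)^{-1}` equals
`∏_{i=1}^{n} (1/(i+1))·binomial(2i,i)`, the product of the first `n` Catalan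
numbers. -/
theorem chan_robbins_yuen (n : ℕ) :
    IterLaurent.CT n
      ((∏ i : Fin n, ((1 - IterLaurent.X n i) ^ 2)⁻¹) *
        ∏ p ∈ Finset.univ.filter (fun p : Fin n × Fin n => p.1 < p.2),
          (IterLaurent.X n p.2 - IterLaurent.X n p.1)⁻¹) =
      ∏ i ∈ Finset.Icc 1 n, (1 / ((i : ℚ) + 1)) * (Nat.choose (2 * i) i : ℚ) := by
  have h : (∏ i : Fin n, ((1 - IterLaurent.X n i) ^ 2)⁻¹) *
      ∏ p ∈ Finset.univ.filter (fun p : Fin n × Fin n => p.1 < p.2),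
        (IterLaurent.X n p.2 - IterLaurent.X n p.1)⁻¹ =
      ((∏ i, (1 - IterLaurent.X n i) ^ 2) * vandermondeProd (IterLaurent.X n))⁻¹ := by
    rw [vandermondeProd, mul_inv, Finset.prod_inv_distrib, Finset.prod_inv_distrib]
  rw [h, IterLaurent.CT_inv_eq_prod_catalan]
  refine Finset.prod_congr rfl fun i _ => ?_
  have hc := succ_mul_catalan_eq_centralBinom i
  rw [Nat.centralBinom_eq_two_mul_choose] at hc
  rw [← hc]
  push_cast
  field_simp
end

section
/- For every integer n ≥ 1, define M_n = (1/n!) · ∏_{j=0}^{n-1} [Γ(2 + (n-1+j)/2) · Γ(1/2)] / [Γ(2 + j/2) · Γ(1/2 + j/2) · Γ(j/2 + 1)], i.e. the right-hand side of the Morris identity specialized at a = 2, b = 0, c = 1/2. Then M_n = ∏_{i=1}^{n} (1/(i+1)) · binomial(2i, i), the product of the first n Catalan numbers. -/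
/-- The right-hand side of the Morris constant term identity specialized at
`a = 2`, `b = 0`, `c = 1/2`:
`M n = (1/n!) ∏_{j=0}^{n-1} Γ(2+(n-1+j)/2)Γ(1/2) / (Γ(2+j/2)Γ(1/2+j/2)Γ(j/2+1))`. -/
noncomputable def morrisRHS (n : ℕ) : ℝ :=
  (1 / (Nat.factorial n : ℝ)) *
    ∏ j ∈ Finset.range n,
      (Real.Gamma (2 + ((n : ℝ) - 1 + j) / 2) * Real.Gamma (1 / 2)) /
        (Real.Gamma (2 + (j : ℝ) / 2) * Real.Gamma (1 / 2 + (j : ℝ) / 2) *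
          Real.Gamma ((j : ℝ) / 2 + 1))

/-- Legendre's duplication formula at half-integers. -/
theorem Real.Gamma_half_mul_Gamma_half_succ (k : ℕ) :
    Real.Gamma (((k : ℝ) + 1) / 2) * Real.Gamma (((k : ℝ) + 2) / 2) =
      √Real.pi * (k.factorial : ℝ) / 2 ^ k := by
  have h := Real.Gamma_mul_Gamma_add_half (((k : ℝ) + 1) / 2)
  rw [show ((k : ℝ) + 1) / 2 + 1 / 2 = ((k : ℝ) + 2) / 2 by ring,
    show 2 * (((k : ℝ) + 1) / 2) = (k : ℝ) + 1 by ring,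
    show 1 - ((k : ℝ) + 1) = -(k : ℝ) by ring, Real.Gamma_nat_eq_factorial,
    Real.rpow_neg (by norm_num), Real.rpow_natCast] at h
  rw [h]
  ring

theorem Finset.prod_range_shift_succ {M : Type*} [CommMonoid M] (f : ℕ → M) (n : ℕ) :
    (∏ j ∈ Finset.range (n + 1), f (n + 1 + j)) * f n =
      (∏ j ∈ Finset.range n, f (n + j)) * f (2 * n) * f (2 * n + 1) := by
  have h := Finset.prod_range_succ' (fun j => f (n + j)) (n + 1)
  rw [Finset.prod_range_succ, Finset.prod_range_succ] at h
  simpa [two_mul, add_assoc, add_comm, add_left_comm] using h.symm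

theorem morrisRHS_eq_div (n : ℕ) :
    morrisRHS n = (∏ j ∈ Finset.range n, Real.Gamma ((((n + j : ℕ) : ℝ) + 3) / 2)) /
      (n.factorial * ∏ j ∈ Finset.range n,
        (Real.Gamma (((j : ℝ) + 4) / 2) * (j.factorial : ℝ) / 2 ^ j)) := by
  rw [morrisRHS, one_div_mul_eq_div, mul_comm, ← div_div, ← Finset.prod_div_distrib]
  congr 1
  refine Finset.prod_congr rfl fun j _ => ?_
  have h := Real.Gamma_half_mul_Gamma_half_succ j
  have hπ : √Real.pi ≠ 0 := (Real.sqrt_pos.2 Real.pi_pos).ne'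
  rw [mul_assoc (Real.Gamma (2 + (j : ℝ) / 2)),
    show 1 / 2 + (j : ℝ) / 2 = ((j : ℝ) + 1) / 2 by ring,
    show (j : ℝ) / 2 + 1 = ((j : ℝ) + 2) / 2 by ring, h, Real.Gamma_one_half_eq,
    show 2 + (j : ℝ) / 2 = ((j : ℝ) + 4) / 2 by ring,
    show 2 + ((n : ℝ) - 1 + j) / 2 = (((n + j : ℕ) : ℝ) + 3) / 2 by push_cast; ring]
  field_simp

theorem morrisRHS_succ (n : ℕ) :
    morrisRHS (n + 1) = morrisRHS n * (catalan (n + 1) : ℝ) := by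
  have hG : ∀ x : ℝ, 0 < x → Real.Gamma x ≠ 0 := fun x hx => (Real.Gamma_pos_of_pos hx).ne'
  have hshift := Finset.prod_range_shift_succ (fun k : ℕ => Real.Gamma (((k : ℝ) + 3) / 2)) n
  have h1 := Real.Gamma_half_mul_Gamma_half_succ (n + 2)
  have h2 := Real.Gamma_half_mul_Gamma_half_succ (2 * n + 2)
  have hcat : (catalan (n + 1) : ℝ) * ((n + 2).factorial * (n + 1).factorial) =
      (2 * n + 2).factorial := by
    have h := succ_mul_catalan_eq_centralBinom (n + 1)
    have h' := Nat.choose_mul_factorial_mul_factorial (show n + 1 ≤ 2 * (n + 1) by omega)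
    rw [← Nat.centralBinom_eq_two_mul_choose, ← h,
      show 2 * (n + 1) - (n + 1) = n + 1 by omega] at h'
    rw [show 2 * n + 2 = 2 * (n + 1) by ring, ← h', Nat.factorial_succ (n + 1)]
    push_cast
    ring
  have hB : (∏ j ∈ Finset.range n,
      (Real.Gamma (((j : ℝ) + 4) / 2) * (j.factorial : ℝ) / 2 ^ j)) ≠ 0 :=
    Finset.prod_ne_zero_iff.2 fun j _ => by
      have := hG (((j : ℝ) + 4) / 2) (by positivity)
      positivity
  have h3 := hG (((n : ℝ) + 3) / 2) (by positivity)
  have h4 := hG (((n : ℝ) + 4) / 2) (by positivity)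
  have hπ : √Real.pi ≠ 0 := (Real.sqrt_pos.2 Real.pi_pos).ne'
  rw [morrisRHS_eq_div, morrisRHS_eq_div, Finset.prod_range_succ (fun j : ℕ =>
    Real.Gamma (((j : ℝ) + 4) / 2) * (j.factorial : ℝ) / 2 ^ j)]
  generalize (∏ j ∈ Finset.range n,
      (Real.Gamma (((j : ℝ) + 4) / 2) * (j.factorial : ℝ) / 2 ^ j)) = B at *
  generalize (∏ j ∈ Finset.range n, Real.Gamma ((((n + j : ℕ) : ℝ) + 3) / 2)) = A at *
  generalize (∏ j ∈ Finset.range (n + 1), Real.Gamma ((((n + 1 + j : ℕ) : ℝ) + 3) / 2)) = A' at *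
  push_cast at h1 h2 hshift
  rw [show (n : ℝ) + 2 + 1 = n + 3 by ring, show (n : ℝ) + 2 + 2 = n + 4 by ring] at h1
  rw [show 2 * (n : ℝ) + 2 + 1 = 2 * n + 3 by ring,
    show 2 * (n : ℝ) + 2 + 2 = 2 * n + 1 + 3 by ring] at h2
  rw [mul_assoc A, h2, ← hcat] at hshift
  have hA : A' = A * (√Real.pi * ((catalan (n + 1) : ℝ) *
      ((n + 2).factorial * (n + 1).factorial)) / 2 ^ (2 * n + 2)) /
      Real.Gamma (((n : ℝ) + 3) / 2) := by
    rw [eq_div_iff h3, hshift]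
  have hg : Real.Gamma (((n : ℝ) + 4) / 2) =
      √Real.pi * ((n + 2).factorial : ℝ) / 2 ^ (n + 2) / Real.Gamma (((n : ℝ) + 3) / 2) := by
    rw [eq_div_iff h3, mul_comm, h1]
  rw [hA, hg]
  field_simp
  ring

/-- The specialization `M_n` of the Morris identity right-hand side at
`a = 2`, `b = 0`, `c = 1/2` equals the product of the first `n` Catalan numbers
`∏_{i=1}^{n} (1/(i+1))·binomial(2i,i)`. -/
theorem morrisRHS_eq_prod_catalan (n : ℕ) (hn : 1 ≤ n) :
    morrisRHS n =
      ∏ i ∈ Finset.Icc 1 n, (1 / ((i : ℝ) + 1)) * (Nat.choose (2 * i) i : ℝ) := by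
  clear hn
  induction n with
  | zero => simp [morrisRHS]
  | succ n ih =>
    rw [morrisRHS_succ, ih, Finset.prod_Icc_succ_top (by omega)]
    congr 1
    have h := succ_mul_catalan_eq_centralBinom (n + 1)
    rw [← Nat.centralBinom_eq_two_mul_choose, ← h]
    push_cast
    field_simp
end

section
/- For every integer n ≥ 2, define M_n = (1/n!) · ∏_{j=0}^{n-1} [Γ(2 + (n-1+j)/2) · Γ(1/2)] / [Γ(2 + j/2) · Γ(1/2 + j/2) · Γ(j/2 + 1)], where Γ is the real Gamma function. Then the ratio M_n / M_{n-1} equals the n-th Catalan number, i.e. M_n / M_{n-1} = binomial(2n, n) / (n + 1). -/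
/-- Shifting the window of a product over `p + 1` consecutive indices starting at `p`. -/
lemma prod_range_window_succ (h : ℕ → ℝ) (p : ℕ) :
    (∏ j ∈ Finset.range (p + 2), h (p + 1 + j)) * h p =
      (∏ j ∈ Finset.range (p + 1), h (p + j)) * (h (2 * p + 1) * h (2 * p + 2)) := by
  have key : (∏ j ∈ Finset.range (p + 2), h (p + 1 + j)) * h p =
      ∏ j ∈ Finset.range (p + 3), h (p + j) := by
    rw [Finset.prod_range_succ' _ (p + 2)]
    simp only [add_zero]
    congr 1
    exact Finset.prod_congr rfl fun j _ => by congr 1; ring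
  rw [key, Finset.prod_range_succ, Finset.prod_range_succ, mul_assoc]
  congr 3 <;> ring

/-- The Legendre duplication formula at `s = (k + 1) / 2`, in terms of a factorial. -/
lemma Gamma_half_mul_Gamma_half_add_half (k : ℕ) :
    Real.Gamma (((k : ℝ) + 1) / 2) * Real.Gamma (((k : ℝ) + 1) / 2 + 1 / 2) * 2 ^ k =
      (k.factorial : ℝ) * √Real.pi := by
  rw [Real.Gamma_mul_Gamma_add_half, mul_div_cancel₀ _ (two_ne_zero' ℝ),
    Real.Gamma_nat_eq_factorial, show (1 : ℝ) - (k + 1) = -(k : ℝ) by ring,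
    Real.rpow_neg zero_le_two, Real.rpow_natCast]
  field_simp

/-- `morrisRHS (m + 1)` with its product split into a numerator and a denominator. -/
lemma morrisRHS_succ_s3 (m : ℕ) :
    morrisRHS (m + 1) = (1 / ((m + 1).factorial : ℝ)) *
      ((∏ j ∈ Finset.range (m + 1), Real.Gamma (2 + ((m + j : ℕ) : ℝ) / 2)) *
        ∏ j ∈ Finset.range (m + 1), Real.Gamma (1 / 2) /
          (Real.Gamma (2 + (j : ℝ) / 2) * Real.Gamma (1 / 2 + (j : ℝ) / 2) *
            Real.Gamma ((j : ℝ) / 2 + 1))) := by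
  rw [morrisRHS, ← Finset.prod_mul_distrib]
  congr 1
  refine Finset.prod_congr rfl fun j _ => ?_
  rw [mul_div_assoc]
  congr 3
  push_cast
  ring

/-- For `n ≥ 2`, the ratio `M_n / M_{n-1}` of consecutive values of the Morris
identity right-hand side specialized at `a = 2`, `b = 0`, `c = 1/2` is the `n`-th
Catalan number `binomial(2n, n)/(n+1)`. -/
theorem morrisRHS_ratio_eq_catalan (n : ℕ) (hn : 2 ≤ n) :
    morrisRHS n / morrisRHS (n - 1) = (Nat.choose (2 * n) n : ℝ) / ((n : ℝ) + 1) := by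
  obtain ⟨p, rfl⟩ := Nat.exists_eq_add_of_le' hn
  rw [show p + 2 - 1 = p + 1 from rfl, morrisRHS_succ_s3 p, morrisRHS_succ_s3 (p + 1),
    Finset.prod_range_succ (fun j : ℕ => Real.Gamma (1 / 2) / _) (p + 1)]
  have window := prod_range_window_succ (fun k => Real.Gamma (2 + (k : ℝ) / 2)) p
  have dup₁ := Gamma_half_mul_Gamma_half_add_half (p + 1)
  have dup₂ := Gamma_half_mul_Gamma_half_add_half (p + 3)
  have dup₃ := Gamma_half_mul_Gamma_half_add_half (2 * p + 4)
  have choose_eq : (((2 * (p + 2)).choose (p + 2) : ℕ) : ℝ) *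
      (p + 2).factorial * (p + 2).factorial = (2 * p + 4).factorial := by
    have := Nat.choose_mul_factorial_mul_factorial (show p + 2 ≤ 2 * (p + 2) by lia)
    rw [show 2 * (p + 2) - (p + 2) = p + 2 by lia, show 2 * (p + 2) = 2 * p + 4 by ring] at this
    exact_mod_cast this
  have hA : 0 < ∏ j ∈ Finset.range (p + 2), Real.Gamma (2 + ((p + 1 + j : ℕ) : ℝ) / 2) :=
    Finset.prod_pos fun j _ => Real.Gamma_pos_of_pos (by positivity)
  have hB : 0 < ∏ j ∈ Finset.range (p + 1), Real.Gamma (2 + ((p + j : ℕ) : ℝ) / 2) :=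
    Finset.prod_pos fun j _ => Real.Gamma_pos_of_pos (by positivity)
  have hD : 0 < ∏ j ∈ Finset.range (p + 1), Real.Gamma (1 / 2) /
      (Real.Gamma (2 + (j : ℝ) / 2) * Real.Gamma (1 / 2 + (j : ℝ) / 2) *
        Real.Gamma ((j : ℝ) / 2 + 1)) :=
    Finset.prod_pos fun j _ => by
      have := Real.Gamma_pos_of_pos (show (0 : ℝ) < 1 / 2 by positivity)
      have := Real.Gamma_pos_of_pos (show (0 : ℝ) < 2 + (j : ℝ) / 2 by positivity)
      have := Real.Gamma_pos_of_pos (show (0 : ℝ) < 1 / 2 + (j : ℝ) / 2 by positivity)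
      have := Real.Gamma_pos_of_pos (show (0 : ℝ) < (j : ℝ) / 2 + 1 by positivity)
      positivity
  have hg₀ := Real.Gamma_pos_of_pos (show (0 : ℝ) < 2 + (p : ℝ) / 2 by positivity)
  have hg₁ := Real.Gamma_pos_of_pos (show (0 : ℝ) < 2 + ((p + 1 : ℕ) : ℝ) / 2 by positivity)
  have hg₂ := Real.Gamma_pos_of_pos (show (0 : ℝ) < 1 / 2 + ((p + 1 : ℕ) : ℝ) / 2 by positivity)
  have hg₃ := Real.Gamma_pos_of_pos (show (0 : ℝ) < ((p + 1 : ℕ) : ℝ) / 2 + 1 by positivity)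
  rw [show (((p + 1 : ℕ) : ℝ) + 1) / 2 = 1 / 2 + ((p + 1 : ℕ) : ℝ) / 2 by ring,
    show 1 / 2 + ((p + 1 : ℕ) : ℝ) / 2 + 1 / 2 = ((p + 1 : ℕ) : ℝ) / 2 + 1 by ring] at dup₁
  rw [show (((p + 3 : ℕ) : ℝ) + 1) / 2 = 2 + (p : ℝ) / 2 by push_cast; ring,
    show 2 + (p : ℝ) / 2 + 1 / 2 = 2 + ((p + 1 : ℕ) : ℝ) / 2 by push_cast; ring] at dup₂
  rw [show (((2 * p + 4 : ℕ) : ℝ) + 1) / 2 = 2 + ((2 * p + 1 : ℕ) : ℝ) / 2 by push_cast; ring,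
    show 2 + ((2 * p + 1 : ℕ) : ℝ) / 2 + 1 / 2 = 2 + ((2 * p + 2 : ℕ) : ℝ) / 2 by
      push_cast; ring, ← choose_eq] at dup₃
  rw [Real.Gamma_one_half_eq]
  simp only [Real.Gamma_one_half_eq] at hD
  generalize (∏ j ∈ Finset.range (p + 2), Real.Gamma (2 + ((p + 1 + j : ℕ) : ℝ) / 2)) = A at *
  generalize (∏ j ∈ Finset.range (p + 1), Real.Gamma (2 + ((p + j : ℕ) : ℝ) / 2)) = B at *
  generalize (∏ j ∈ Finset.range (p + 1), √Real.pi /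
      (Real.Gamma (2 + (j : ℝ) / 2) * Real.Gamma (1 / 2 + (j : ℝ) / 2) *
        Real.Gamma ((j : ℝ) / 2 + 1))) = D at *
  generalize Real.Gamma (2 + (p : ℝ) / 2) = g₀ at *
  generalize Real.Gamma (2 + ((p + 1 : ℕ) : ℝ) / 2) = g₁ at *
  generalize Real.Gamma (1 / 2 + ((p + 1 : ℕ) : ℝ) / 2) = g₂ at *
  generalize Real.Gamma (((p + 1 : ℕ) : ℝ) / 2 + 1) = g₃ at *
  generalize Real.Gamma (2 + ((2 * p + 1 : ℕ) : ℝ) / 2) = x at *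
  generalize Real.Gamma (2 + ((2 * p + 2 : ℕ) : ℝ) / 2) = y at *
  generalize (((2 * (p + 2)).choose (p + 2) : ℕ) : ℝ) = C at *
  have hs : 0 < √Real.pi := Real.sqrt_pos.2 Real.pi_pos
  generalize √Real.pi = s at *
  simp only [Nat.factorial_succ (p + 1), Nat.factorial_succ (p + 2)] at dup₂ dup₃ ⊢
  have hf : (0 : ℝ) < (p + 1).factorial := by positivity
  push_cast at *
  generalize ((p + 1).factorial : ℝ) = f at *
  have key : A * s * (p + 3) = C * (p + 2) * B * (g₁ * g₂ * g₃) := by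
    refine mul_right_cancel₀ (show g₀ * 2 ^ (2 * p + 4) ≠ 0 by positivity) ?_
    calc A * s * (p + 3) * (g₀ * 2 ^ (2 * p + 4))
        = (A * g₀) * s * (p + 3) * 2 ^ (2 * p + 4) := by ring
      _ = B * (x * y * 2 ^ (2 * p + 4)) * s * (p + 3) := by rw [window]; ring
      _ = C * (p + 2) * B * (g₂ * g₃ * 2 ^ (p + 1)) * (g₀ * g₁ * 2 ^ (p + 3)) := by
        rw [dup₁, dup₂, dup₃]; ring
      _ = C * (p + 2) * B * (g₁ * g₂ * g₃) * (g₀ * 2 ^ (2 * p + 4)) := by ring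
  have reduced : 1 / ((p + 1 + 1) * f) * (A * (D * (s / (g₁ * g₂ * g₃)))) / (1 / f * (B * D)) =
      A * s / ((p + 2) * B * (g₁ * g₂ * g₃)) := by
    rw [show (p : ℝ) + 1 + 1 = p + 2 by ring]
    field_simp
  rw [reduced, div_eq_div_iff (by positivity) (by positivity)]
  linear_combination key
end
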